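/- arXiv:0908.3340 — 3 statements merged into one kernel-verified Lean document; each statement's English description precedes it below -/
import Mathlib

section
/- (Transpose-invariance criterion TI.) Let g ∈ GSp6(k) and X = Sᵀ·g·S. Suppose there exist s1, s2 ∈ Δ(GL2) with s1·g·s2 = gᵀ. Then Xᵀ = X, and every (S,ψ,T)-invariant distribution T on X is transpose-invariant: T(x ↦ f(xᵀ)) = T(f) for all f ∈ C_c^∞(X). -/
open Matrix Pointwise

/-- 2×2 matrices over `k`. -/
abbrev M2 (k : Type*) [Field k] := Matrix (Fin 2) (Fin 2) k

/-- 6×6 matrices over `k`. -/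
abbrev M6 (k : Type*) [Field k] := Matrix (Fin 6) (Fin 6) k

variable {k : Type*} [Field k]

/-- The 2×2 matrix `J = [[0,-1],[1,0]]`. -/
def Jmat : M2 k := !![0, -1; 1, 0]

/-- Build a 6×6 matrix from a 3×3 array of 2×2 blocks. -/
def blk (M : Fin 3 → Fin 3 → M2 k) : M6 k :=
  Matrix.of fun i j =>
    M ⟨i.val / 2, by have := i.isLt; omega⟩ ⟨j.val / 2, by have := j.isLt; omega⟩
      ⟨i.val % 2, by have := i.isLt; omega⟩ ⟨j.val % 2, by have := j.isLt; omega⟩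

/-- Block diagonal 6×6 matrix with 2×2 blocks `g`, `h`, `m`. -/
def bdiag (g h m : M2 k) : M6 k := blk ![![g, 0, 0], ![0, h, 0], ![0, 0, m]]

/-- The block upper unitriangular matrix `[[I,X,Z],[0,I,Y],[0,0,I]]`. -/
def Umat (X Y Z : M2 k) : M6 k := blk ![![1, X, Z], ![0, 1, Y], ![0, 0, 1]]

/-- The 6×6 matrix `J3` with 2×2 blocks `[[0,0,J],[0,J,0],[J,0,0]]`. -/
def J3 : M6 k := blk ![![0, 0, Jmat], ![0, Jmat, 0], ![Jmat, 0, 0]]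

/-- The group of symplectic similitudes `GSp6(k)`, as a subset of the 6×6 matrices. -/
def GSp6 (k : Type*) [Field k] : Set (M6 k) :=
  {g | IsUnit g ∧ ∃ l : kˣ, g * J3 * gᵀ = (l : k) • (J3 : M6 k)}

/-- The Levi subgroup `L3 = { blockdiag(g, h, det(g⁻¹h)·g) }`. -/
def L3 (k : Type*) [Field k] : Set (M6 k) :=
  {m | ∃ g h : M2 k, IsUnit g ∧ IsUnit h ∧ m = bdiag g h ((g⁻¹ * h).det • g)}

/-- The unipotent radical `U3`. -/
def U3 (k : Type*) [Field k] : Set (M6 k) :=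
  {m | ∃ X Y Z : M2 k, X * Jmat + Jmat * Yᵀ = 0 ∧
    Z * Jmat + Jmat * Zᵀ = -(X * Jmat * Xᵀ) ∧ m = Umat X Y Z}

/-- The parabolic subgroup `Q3 = L3 · U3`. -/
def Q3 (k : Type*) [Field k] : Set (M6 k) := L3 k * U3 k

/-- The diagonal embedding `Δ(g) = blockdiag(g,g,g)`. -/
def Dmat (g : M2 k) : M6 k := bdiag g g g

/-- The diagonal copy `Δ(GL2)` of `GL2` in `GSp6`. -/
def DeltaGL2 (k : Type*) [Field k] : Set (M6 k) := {m | ∃ g : M2 k, IsUnit g ∧ m = Dmat g}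

/-- The embedding `η(g) = blockdiag(I, g, det(g)·I)`. -/
def etaMat (g : M2 k) : M6 k := bdiag 1 g (g.det • (1 : M2 k))

/-- The copy `η(GL2)` of `GL2` in `GSp6`. -/
def etaGL2 (k : Type*) [Field k] : Set (M6 k) := {m | ∃ g : M2 k, IsUnit g ∧ m = etaMat g}

/-- The Shalika subgroup `S = Δ(GL2) · U3`. -/
def Sgrp (k : Type*) [Field k] : Set (M6 k) := DeltaGL2 k * U3 k

/-- For a subset `H` of the 6×6 matrices, `Hᵀ = { hᵀ : h ∈ H }`. -/
def setT (H : Set (M6 k)) : Set (M6 k) := Matrix.transpose '' H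

/-- The Weyl element `a = blockdiag(J, I, J)`. -/
def amat : M6 k := bdiag Jmat 1 Jmat

/-- The Weyl element `c = blockdiag(I, J, I)`. -/
def cmat : M6 k := bdiag 1 Jmat 1

/-- The Weyl element `b`. -/
def bmat : M6 k :=
  !![1,0,0,0,0,0; 0,0,1,0,0,0; 0,-1,0,0,0,0; 0,0,0,0,1,0; 0,0,0,-1,0,0; 0,0,0,0,0,1]

/-- The set `Σ = {1, b, b·c·b, b·a·c·b, b·c·a·b·a·c·b}` of double coset representatives. -/
def SigmaSet (k : Type*) [Field k] : Set (M6 k) :=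
  {1, bmat, bmat * cmat * bmat, bmat * amat * cmat * bmat,
    bmat * cmat * amat * bmat * amat * cmat * bmat}

/-- The space `C_c^∞(X)` of locally constant, compactly supported functions `X → ℂ`, for a
subset `X` of the 6×6 matrices over a topological field. -/
def Cc {k : Type*} [Field k] [TopologicalSpace k] (X : Set (M6 k)) :
    Set ({m : M6 k // m ∈ X} → ℂ) :=
  {f | IsLocallyConstant f ∧ HasCompactSupport f}

/-- An `(S,ψ,T)`-invariant distribution on a subset `X ⊆ GSp6(k)` with `Sᵀ·X·S = X`: a
`ℂ`-linear functional `T` on `C_c^∞(X)` such that `T(x ↦ f(s⁻¹·x·t)) = ψ_Sᵀ(s)·ψ_S(t)⁻¹·T(f)`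
for all `s ∈ Sᵀ` and `t ∈ S`.  (The values of `T` outside `C_c^∞(X)` are irrelevant.) -/
def IsInvariantDistrib {k : Type*} [Field k] [TopologicalSpace k]
    (ψS : M6 k → ℂˣ) (X : Set (M6 k)) (T : ({m : M6 k // m ∈ X} → ℂ) → ℂ) : Prop :=
  (∀ f g, f ∈ Cc X → g ∈ Cc X → T (f + g) = T f + T g) ∧
  (∀ (c : ℂ) f, f ∈ Cc X → T (c • f) = c * T f) ∧
  (∀ s ∈ setT (Sgrp k), ∀ t ∈ Sgrp k, ∀ f f', f ∈ Cc X → f' ∈ Cc X →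
    (∀ (x : M6 k) (hx : x ∈ X) (hx' : s⁻¹ * x * t ∈ X),
      f' ⟨x, hx⟩ = f ⟨s⁻¹ * x * t, hx'⟩) →
    T f' = (ψS sᵀ : ℂ) * (ψS t : ℂ)⁻¹ * T f)

/-- The defining properties of the Shalika character `ψ_S` (extended arbitrarily to all 6×6
matrices; only its values on `S` matter): it is multiplicative on `S`, equals
`ψ_k(−tr X)` on `U3`, and equals `1` on `Δ(GL2)`. -/
def IsShalikaCharacter {k : Type*} [Field k] (ψk : k → ℂˣ) (ψS : M6 k → ℂˣ) : Prop :=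
  (∀ x ∈ Sgrp k, ∀ y ∈ Sgrp k, ψS (x * y) = ψS x * ψS y) ∧
  (∀ X Y Z : M2 k, X * Jmat + Jmat * Yᵀ = 0 →
    Z * Jmat + Jmat * Zᵀ = -(X * Jmat * Xᵀ) → ψS (Umat X Y Z) = ψk (-(X.trace))) ∧
  (∀ g : M2 k, IsUnit g → ψS (Dmat g) = 1)

/-! ### Abstract part: semi-invariant distributions on a homogeneous space -/

section AbstractPart

open Topology

set_option linter.unusedSectionVars false

/-- Locally constant compactly supported functions. -/
def TIsb (X : Type*) [TopologicalSpace X] : Set (X → ℂ) :=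
  {f | IsLocallyConstant f ∧ HasCompactSupport f}

/-- Semi-invariant functionals. -/
def TISemi {G X : Type*} [Group G] [TopologicalSpace X] [MulAction G X] (χ : G → ℂ)
    (T : (X → ℂ) → ℂ) : Prop :=
  (∀ f g, f ∈ TIsb X → g ∈ TIsb X → T (f + g) = T f + T g) ∧
  (∀ (c : ℂ) f, f ∈ TIsb X → T (c • f) = c * T f) ∧
  (∀ (g : G) f, f ∈ TIsb X → T (fun x => f (g⁻¹ • x)) = χ g * T f)

theorem TIsb_zero {X : Type*} [TopologicalSpace X] : (0 : X → ℂ) ∈ TIsb X :=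
  ⟨IsLocallyConstant.const 0, HasCompactSupport.zero⟩

theorem TIsb_add {X : Type*} [TopologicalSpace X] {f g : X → ℂ} (hf : f ∈ TIsb X)
    (hg : g ∈ TIsb X) : f + g ∈ TIsb X :=
  ⟨hf.1.add hg.1, hf.2.add hg.2⟩

theorem TIsb_smul {X : Type*} [TopologicalSpace X] (c : ℂ) {f : X → ℂ} (hf : f ∈ TIsb X) :
    c • f ∈ TIsb X :=
  ⟨hf.1.comp (fun z => c • z), hf.2.comp_left (g := fun z => c • z) (by simp)⟩

theorem TIsb_sum {X ι : Type*} [TopologicalSpace X] (s : Finset ι) (F : ι → X → ℂ)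
    (hF : ∀ i ∈ s, F i ∈ TIsb X) : ∑ i ∈ s, F i ∈ TIsb X := by
  classical
  induction s using Finset.induction_on with
  | empty => simpa using TIsb_zero
  | insert a s ha ih =>
    rw [Finset.sum_insert ha]
    exact TIsb_add (hF a (by simp)) (ih fun i hi => hF i (by simp [hi]))

theorem TIsb_homeo {X : Type*} [TopologicalSpace X] (e : X ≃ₜ X) {f : X → ℂ} (hf : f ∈ TIsb X) :
    (fun x => f (e x)) ∈ TIsb X :=
  ⟨hf.1.comp_continuous e.continuous, hf.2.comp_homeomorph e⟩

variable {G X : Type*} [Group G] [TopologicalSpace G] [IsTopologicalGroup G]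
  [TopologicalSpace X] [T2Space X] [MulAction G X] [ContinuousSMul G X]

theorem TISemi.zero {χ : G → ℂ} {T : (X → ℂ) → ℂ} (hT : TISemi χ T) : T 0 = 0 := by
  have := hT.2.1 0 0 TIsb_zero
  simpa using this

theorem TISemi.sum {χ : G → ℂ} {T : (X → ℂ) → ℂ} (hT : TISemi χ T) {ι : Type*}
    (s : Finset ι) (F : ι → X → ℂ)
    (hF : ∀ i ∈ s, F i ∈ TIsb X) : T (∑ i ∈ s, F i) = ∑ i ∈ s, T (F i) := by
  classical
  induction s using Finset.induction_on with
  | empty => simpa using hT.zero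
  | insert a s ha ih =>
    have h1 : ∀ i ∈ s, F i ∈ TIsb X := fun i hi => hF i (by simp [hi])
    rw [Finset.sum_insert ha, Finset.sum_insert ha, ← ih h1]
    exact hT.1 _ _ (hF a (by simp)) (TIsb_sum _ _ h1)

/-- Good subgroups: compact open, with trivial character. -/
def TIGood (χ : G → ℂ) (K : Subgroup G) : Prop :=
  IsOpen (K : Set G) ∧ IsCompact (K : Set G) ∧ ∀ k ∈ K, χ k = 1

/-- Indicator function of the orbit `K • x`. -/
noncomputable def TIind (K : Subgroup G) (x : X) : X → ℂ :=
  Set.indicator ((fun g : G => g • x) '' (K : Set G)) 1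

theorem TIind_mem {χ : G → ℂ} (hopen : ∀ x : X, IsOpenMap (fun g : G => g • x))
    {K : Subgroup G} (hK : TIGood χ K) (x : X) : TIind K x ∈ TIsb X := by
  have ho : IsOpen ((fun g : G => g • x) '' (K : Set G)) := hopen x _ hK.1
  have hc : IsCompact ((fun g : G => g • x) '' (K : Set G)) :=
    hK.2.1.image (by fun_prop)
  refine ⟨?_, ?_⟩
  · have h1 := LocallyConstant.coe_charFn ℂ (U := (fun g : G => g • x) '' (K : Set G))
      ⟨hc.isClosed, ho⟩
    unfold TIind
    rw [← h1]
    exact LocallyConstant.isLocallyConstant _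
  · exact HasCompactSupport.intro hc fun y hy => Set.indicator_of_notMem hy _

theorem TIind_smul_inv {K : Subgroup G} {k : G} (hk : k ∈ K) (x y : X) :
    TIind K x (k⁻¹ • y) = TIind K x y := by
  classical
  unfold TIind
  simp only [Set.indicator_apply]
  congr 1
  simp only [Set.mem_image, SetLike.mem_coe, eq_iff_iff]
  constructor
  · rintro ⟨g, hg, h⟩
    exact ⟨k * g, K.mul_mem hk hg, by rw [mul_smul, h, smul_inv_smul]⟩
  · rintro ⟨g, hg, h⟩
    exact ⟨k⁻¹ * g, K.mul_mem (K.inv_mem hk) hg, by rw [mul_smul, h]⟩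

theorem TIGood.finite {χ : G → ℂ} {K L : Subgroup G} (hK : TIGood χ K) (hL : TIGood χ L) :
    Finite (K ⧸ L.subgroupOf K) := by
  have : CompactSpace K := isCompact_iff_compactSpace.mp hK.2.1
  exact Subgroup.quotient_finite_of_isOpen _ (Subgroup.subgroupOf_isOpen K L hL.1)

theorem TIGood.step {χ : G → ℂ} (hopen : ∀ x : X, IsOpenMap (fun g : G => g • x))
    {K L : Subgroup G} (hK : TIGood χ K) (hL : TIGood χ L) (hLK : L ≤ K) (x : X) :
    ∃ n m : ℕ, 0 < n ∧ 0 < m ∧ ∀ T : (X → ℂ) → ℂ, TISemi χ T →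
      (n : ℂ) * T (TIind L x) = (m : ℂ) * T (TIind K x) := by
  classical
  have := hK.finite hL
  let _ := Fintype.ofFinite (K ⧸ L.subgroupOf K)
  let u : X → ℂ := TIind L x
  have hu : u ∈ TIsb X := TIind_mem hopen hL x
  let Φ : (K ⧸ L.subgroupOf K) → X → ℂ := fun c y => u (((c.out : K) : G)⁻¹ • y)
  have hΦ : ∀ (a : K) (y : X), Φ (QuotientGroup.mk a) y = u ((a : G)⁻¹ • y) := by
    intro a y
    obtain ⟨l, hl⟩ := QuotientGroup.mk_out_eq_mul (L.subgroupOf K) a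
    have hl' : ((l : K) : G) ∈ L := by
      have := l.2
      rwa [Subgroup.mem_subgroupOf] at this
    simp only [Φ, hl]
    rw [Subgroup.coe_mul, _root_.mul_inv_rev, mul_smul]
    exact TIind_smul_inv hl' x _
  have hΦmem : ∀ c, Φ c ∈ TIsb X := fun c =>
    TIsb_homeo (Homeomorph.smul (((c.out : K) : G)⁻¹)) hu
  let F : X → ℂ := ∑ c, Φ c
  have hFinv : ∀ (a : K) (y : X), F ((a : G) • y) = F y := by
    intro a y
    simp only [F, Finset.sum_apply]
    rw [← Equiv.sum_comp (MulAction.toPerm a)]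
    refine Finset.sum_congr rfl fun c _ => ?_
    induction c using QuotientGroup.induction_on with
    | H b =>
      have : (MulAction.toPerm a) (QuotientGroup.mk b : K ⧸ L.subgroupOf K) =
        QuotientGroup.mk (a * b) := rfl
      rw [this, hΦ, hΦ, ← mul_smul]
      congr 2
      simp
  -- the value at the base point is a positive integer
  obtain ⟨m, hm0, hm⟩ : ∃ m : ℕ, 0 < m ∧ F x = m := by
    let s : Finset (K ⧸ L.subgroupOf K) := Finset.univ.filter fun c =>
      (((c.out : K) : G)⁻¹ • x) ∈ ((fun g : G => g • x) '' (L : Set G))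
    refine ⟨s.card, ?_, ?_⟩
    · rw [Finset.card_pos]
      refine ⟨QuotientGroup.mk 1, ?_⟩
      have h1 := hΦ 1 x
      simp only [s, Finset.mem_filter, Finset.mem_univ, true_and]
      by_contra hcon
      have h2 : Φ (QuotientGroup.mk 1) x = 0 := Set.indicator_of_notMem hcon _
      have h3' : (((1 : K) : G)⁻¹ • x) ∈ (fun g : G => g • x) '' (L : Set G) :=
        ⟨1, L.one_mem, by simp⟩
      have h3 : u (((1 : K) : G)⁻¹ • x) = 1 := Set.indicator_of_mem h3' _
      rw [h2, h3] at h1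
      exact zero_ne_one h1
    · simp only [F, Finset.sum_apply, Φ, u, TIind, Set.indicator_apply, s, Pi.one_apply]
      rw [Finset.sum_boole]
  have hF : F = (m : ℂ) • TIind K x := by
    funext y
    by_cases hy : y ∈ (fun g : G => g • x) '' (K : Set G)
    · have h1 : TIind K x y = 1 := Set.indicator_of_mem hy _
      obtain ⟨a, ha, rfl⟩ := hy
      have := hFinv ⟨a, ha⟩ x
      simp only [Pi.smul_apply, h1, smul_eq_mul, mul_one, ← hm]
      exact this
    · have h1 : TIind K x y = 0 := Set.indicator_of_notMem hy _
      simp only [Pi.smul_apply, h1, smul_zero, F, Finset.sum_apply]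
      refine Finset.sum_eq_zero fun c _ => ?_
      refine Set.indicator_of_notMem ?_ _
      rintro ⟨l, hl, h⟩
      apply hy
      refine ⟨((c.out : K) : G) * l, K.mul_mem (c.out : K).2 (hLK hl), ?_⟩
      simp only at h ⊢
      rw [mul_smul, h, smul_inv_smul]
  refine ⟨Fintype.card (K ⧸ L.subgroupOf K), m, Fintype.card_pos, hm0, fun T hT => ?_⟩
  have h1 : T F = ∑ c, T (Φ c) := hT.sum _ _ fun c _ => hΦmem c
  have h2 : ∀ c, T (Φ c) = T u := fun c => by
    have := hT.2.2 ((c.out : K) : G) u hu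
    rw [hK.2.2 _ (c.out : K).2, one_mul] at this
    exact this
  rw [hF, hT.2.1 _ _ (TIind_mem hopen hK x)] at h1
  rw [h1, Finset.sum_congr rfl fun c _ => h2 c]
  simp [u]

theorem TIGood.inf {χ : G → ℂ} {K L : Subgroup G} (hK : TIGood χ K) (hL : TIGood χ L) :
    TIGood χ (K ⊓ L) := by
  refine ⟨?_, ?_, fun k hk => hK.2.2 k hk.1⟩
  · rw [Subgroup.coe_inf]; exact hK.1.inter hL.1
  · rw [Subgroup.coe_inf]; exact hK.2.1.inter_right (L.isClosed_of_isOpen hL.1)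

theorem TIGood.compare {χ : G → ℂ} (hopen : ∀ x : X, IsOpenMap (fun g : G => g • x))
    {K L : Subgroup G} (hK : TIGood χ K) (hL : TIGood χ L) (x : X) :
    ∃ r : ℝ, 0 < r ∧ ∀ T : (X → ℂ) → ℂ, TISemi χ T →
      T (TIind L x) = (r : ℂ) * T (TIind K x) := by
  obtain ⟨n, m, hn, hm, h⟩ := hK.step hopen (hK.inf hL) inf_le_left x
  obtain ⟨n', m', hn', hm', h'⟩ := hL.step hopen (hK.inf hL) inf_le_right x
  refine ⟨(m * n' / (n * m') : ℝ), by positivity, fun T hT => ?_⟩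
  have h1 := h T hT
  have h2 := h' T hT
  have hn0 : (n : ℂ) ≠ 0 := by exact_mod_cast hn.ne'
  have hm0 : (m' : ℂ) ≠ 0 := by exact_mod_cast hm'.ne'
  push_cast
  field_simp
  linear_combination (-(n : ℂ)) * h2 + (n' : ℂ) * h1

/-- Translates of indicator functions. -/
theorem TIind_translate (K : Subgroup G) (g : G) (x : X) :
    (fun y => TIind (K.comap (MulAut.conj g).toMonoidHom) x (g⁻¹ • y)) = TIind K (g • x) := by
  classical
  funext y
  unfold TIind
  simp only [Set.indicator_apply]
  congr 1
  simp only [Set.mem_image, SetLike.mem_coe, eq_iff_iff, Subgroup.mem_comap]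
  constructor
  · rintro ⟨a, ha, h⟩
    refine ⟨_, ha, ?_⟩
    simp [mul_smul, h]
  · rintro ⟨a, ha, h⟩
    refine ⟨g⁻¹ * a * g, ?_, ?_⟩
    · simpa [mul_assoc] using ha
    · simp [mul_smul, h]

theorem TIGood.conj {χ : G →* ℂ} {K : Subgroup G} (hK : TIGood χ K) (g : G) :
    TIGood χ (K.comap (MulAut.conj g).toMonoidHom) := by
  have hc : Continuous (fun a : G => g * a * g⁻¹) := by fun_prop
  refine ⟨hK.1.preimage hc, ?_, fun k hk => ?_⟩
  · have : ((K.comap (MulAut.conj g).toMonoidHom : Subgroup G) : Set G) =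
        (fun a : G => g⁻¹ * a * g) '' (K : Set G) := by
      ext a
      simp only [Subgroup.coe_comap, Set.mem_preimage, Set.mem_image, SetLike.mem_coe]
      constructor
      · intro h
        exact ⟨_, h, by simp [mul_assoc]⟩
      · rintro ⟨b, hb, rfl⟩
        simpa [mul_assoc] using hb
    rw [this]
    exact hK.2.1.image (by fun_prop)
  · have h1 := hK.2.2 _ hk
    have h2 : χ g * χ g⁻¹ = 1 := by rw [← map_mul]; simp
    simp only [MulEquiv.toMonoidHom_eq_coe, MonoidHom.coe_coe, MulAut.conj_apply, map_mul] at h1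
    rw [mul_right_comm, h2, one_mul] at h1
    exact h1

/-- A semi-invariant functional is determined by one value. -/
theorem TISemi.eq_zero {χ : G →* ℂ} (hopen : ∀ x : X, IsOpenMap (fun g : G => g • x))
    (htrans : ∀ x y : X, ∃ g : G, g • x = y)
    (hbasis : ∀ U ∈ 𝓝 (1 : G), ∃ K : Subgroup G, TIGood χ K ∧ (K : Set G) ⊆ U)
    {K₀ : Subgroup G} (hK₀ : TIGood χ K₀) (x₀ : X) {T : (X → ℂ) → ℂ} (hT : TISemi χ T)
    (h0 : T (TIind K₀ x₀) = 0) (f : X → ℂ) (hf : f ∈ TIsb X) : T f = 0 := by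
  classical
  -- all indicator functions are killed
  have hind : ∀ (K : Subgroup G), TIGood χ K → ∀ y : X, T (TIind K y) = 0 := by
    intro K hK y
    obtain ⟨g, rfl⟩ := htrans x₀ y
    rw [← TIind_translate, hT.2.2 _ _ (TIind_mem hopen (hK.conj g) x₀)]
    obtain ⟨r, -, hr⟩ := hK₀.compare hopen (hK.conj g) x₀
    rw [hr T hT, h0]; simp
  -- a subgroup leaving `f` invariant
  have hcov : ∃ K : Subgroup G, TIGood χ K ∧ ∀ y ∈ tsupport f, ∀ k ∈ K, f (k • y) = f y := by
    have hcpt : IsCompact (tsupport f) := hf.2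
    refine hcpt.induction_on
      (p := fun s => ∃ K : Subgroup G, TIGood χ K ∧ ∀ y ∈ s, ∀ k ∈ K, f (k • y) = f y)
      ⟨K₀, hK₀, by simp⟩ ?_ ?_ ?_
    · rintro s t hst ⟨K, hK, h⟩
      exact ⟨K, hK, fun y hy => h y (hst hy)⟩
    · rintro s t ⟨K, hK, h⟩ ⟨L, hL, h'⟩
      refine ⟨K ⊓ L, hK.inf hL, ?_⟩
      rintro y (hy | hy) k hk
      · exact h y hy k hk.1
      · exact h' y hy k hk.2
    · intro y hy
      have hopen1 : IsOpen {z | f z = f y} := hf.1.isOpen_fiber _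
      have hU : {g : G | f (g • y) = f y} ∈ 𝓝 (1 : G) := by
        have hc : Continuous (fun g : G => g • y) := by fun_prop
        exact (hopen1.preimage hc).mem_nhds (by simp)
      obtain ⟨K, hK, hKU⟩ := hbasis _ hU
      refine ⟨(fun g : G => g • y) '' (K : Set G),
        mem_nhdsWithin_of_mem_nhds ((hopen y _ hK.1).mem_nhds ⟨1, K.one_mem, by simp⟩),
        K, hK, ?_⟩
      rintro _ ⟨a, ha, rfl⟩ k hk
      have h1 : f (a • y) = f y := hKU ha
      have h2 : f ((k * a) • y) = f y := hKU (K.mul_mem hk ha)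
      simp only
      rw [← mul_smul, h2, h1]
  obtain ⟨K, hK, hKf⟩ := hcov
  have hinv : ∀ (k : G), k ∈ K → ∀ y, f (k • y) = f y := by
    intro k hk y
    by_cases hy : y ∈ tsupport f
    · exact hKf y hy k hk
    · by_cases hy' : k • y ∈ tsupport f
      · have := hKf _ hy' k⁻¹ (K.inv_mem hk)
        rw [inv_smul_smul] at this
        exact this.symm
      · rw [image_eq_zero_of_notMem_tsupport hy, image_eq_zero_of_notMem_tsupport hy']
  -- finitely many orbits
  have hfin : ∀ (t : Finset X) (f : X → ℂ), f ∈ TIsb X → (∀ k ∈ K, ∀ y, f (k • y) = f y) →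
      (∀ y, f y ≠ 0 → ∃ a ∈ t, y ∈ (fun g : G => g • a) '' (K : Set G)) → T f = 0 := by
    intro t
    induction t using Finset.induction_on with
    | empty =>
      intro f _ _ h
      have : f = 0 := by
        funext y
        by_contra hy
        obtain ⟨a, ha, -⟩ := h y hy
        simp at ha
      rw [this, hT.zero]
    | insert a t hat ih =>
      intro f hf hinv h
      have hm := TIind_mem hopen hK a
      have hm' : (-(f a)) • TIind K a ∈ TIsb X := TIsb_smul _ hm
      have h1 : T (f + (-(f a)) • TIind K a) = 0 := by
        refine ih _ (TIsb_add hf hm') ?_ ?_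
        · intro k hk y
          have := TIind_smul_inv (K.inv_mem hk) a y
          rw [inv_inv] at this
          simp only [Pi.add_apply, Pi.smul_apply, this, hinv k hk y]
        · intro y hy
          by_cases hya : y ∈ (fun g : G => g • a) '' (K : Set G)
          · exfalso
            apply hy
            have h2 : TIind K a y = 1 := Set.indicator_of_mem hya _
            obtain ⟨k, hk, rfl⟩ := hya
            simp only [Pi.add_apply, Pi.smul_apply, smul_eq_mul] at h2 ⊢
            rw [h2, hinv k hk a]; ring
          · have h2 : TIind K a y = 0 := Set.indicator_of_notMem hya _
            simp only [Pi.add_apply, Pi.smul_apply, h2, smul_zero, add_zero] at hy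
            obtain ⟨b, hb, hyb⟩ := h y hy
            rcases Finset.mem_insert.mp hb with rfl | hb
            · exact absurd hyb hya
            · exact ⟨b, hb, hyb⟩
      rw [hT.1 _ _ hf hm', hT.2.1 _ _ hm, hind K hK a, mul_zero, add_zero] at h1
      exact h1
  obtain ⟨t, -, ht⟩ := hf.2.isCompact.elim_nhds_subcover
    (fun y => (fun g : G => g • y) '' (K : Set G))
    (fun y _ => (hopen y _ hK.1).mem_nhds ⟨1, K.one_mem, by simp⟩)
  refine hfin t f hf hinv fun y hy => ?_
  have := ht (subset_tsupport f hy)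
  simpa using this

/-- Main abstract statement. -/
theorem TISemi.invariant {χ : G →* ℂ} (hopen : ∀ x : X, IsOpenMap (fun g : G => g • x))
    (htrans : ∀ x y : X, ∃ g : G, g • x = y)
    (hbasis : ∀ U ∈ 𝓝 (1 : G), ∃ K : Subgroup G, TIGood χ K ∧ (K : Set G) ⊆ U)
    (θ : G ≃* G) (hθ : Continuous θ) (hθ2 : ∀ g, θ (θ g) = g) (hχθ : ∀ g, χ (θ g) = χ g)
    (τ : X ≃ₜ X) (hτ2 : ∀ x, τ (τ x) = x) (hτ : ∀ (g : G) (x : X), τ (g • x) = θ g • τ x)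
    (x₀ : X) (h : G) (hh : χ h = 1) (hx₀ : τ x₀ = h • x₀)
    {T : (X → ℂ) → ℂ} (hT : TISemi χ T) (f : X → ℂ) (hf : f ∈ TIsb X) :
    T (fun x => f (τ x)) = T f := by
  classical
  obtain ⟨K, hK, -⟩ := hbasis _ Filter.univ_mem
  have hKθ : TIGood χ (K.comap θ.toMonoidHom) := by
    refine ⟨hK.1.preimage hθ, ?_, fun k hk => ?_⟩
    · have : ((K.comap θ.toMonoidHom : Subgroup G) : Set G) = θ '' (K : Set G) := by
        ext a
        simp only [Subgroup.coe_comap, Set.mem_preimage, Set.mem_image, SetLike.mem_coe]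
        constructor
        · intro h
          exact ⟨_, h, hθ2 a⟩
        · rintro ⟨b, hb, rfl⟩
          simpa [hθ2] using hb
      rw [this]
      exact hK.2.1.image hθ
    · rw [← hχθ]
      exact hK.2.2 _ hk
  have hindτ : (fun x => TIind K x₀ (τ x)) = TIind (K.comap θ.toMonoidHom) (h • x₀) := by
    funext x
    unfold TIind
    simp only [Set.indicator_apply]
    congr 1
    simp only [Set.mem_image, SetLike.mem_coe, eq_iff_iff, Subgroup.mem_comap]
    constructor
    · rintro ⟨g, hg, e⟩
      refine ⟨θ g, by simpa [hθ2] using hg, ?_⟩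
      rw [← hx₀, ← hτ, e, hτ2]
    · rintro ⟨g, hg, e⟩
      refine ⟨θ g, hg, ?_⟩
      rw [← e, hτ, ← hx₀, hτ2]
  obtain ⟨r, hr0, hr⟩ := hK.compare hopen (hKθ.conj h) x₀
  have hTτ : TISemi χ (fun f => T (fun x => f (τ x))) := by
    refine ⟨fun f g hf hg => ?_, fun c f hf => ?_, fun g f hf => ?_⟩
    · exact hT.1 _ _ (TIsb_homeo τ hf) (TIsb_homeo τ hg)
    · exact hT.2.1 _ _ (TIsb_homeo τ hf)
    · have := hT.2.2 (θ g) _ (TIsb_homeo τ hf)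
      rw [hχθ] at this
      simp only
      rw [← this]
      congr 1
      funext x
      rw [hτ, map_inv, hθ2]
  let D : (X → ℂ) → ℂ := fun f => T (fun x => f (τ x)) - (r : ℂ) * T f
  have hD : TISemi χ D := by
    refine ⟨fun f g hf hg => ?_, fun c f hf => ?_, fun g f hf => ?_⟩
    · have h1 := hTτ.1 f g hf hg
      have h2 := hT.1 f g hf hg
      simp only [D] at h1 ⊢
      rw [h1, h2]; ring
    · have h1 := hTτ.2.1 c f hf
      have h2 := hT.2.1 c f hf
      simp only [D] at h1 ⊢
      rw [h1, h2]; ring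
    · have h1 := hTτ.2.2 g f hf
      have h2 := hT.2.2 g f hf
      simp only [D] at h1 ⊢
      rw [h1, h2]; ring
  have hD0 : D (TIind K x₀) = 0 := by
    simp only [D]
    rw [hindτ, ← TIind_translate, hT.2.2 _ _ (TIind_mem hopen (hKθ.conj h) x₀), hh, one_mul,
      hr T hT, sub_self]
  have hTr : ∀ f ∈ TIsb X, T (fun x => f (τ x)) = (r : ℂ) * T f := fun f hf =>
    sub_eq_zero.mp (hD.eq_zero hopen htrans hbasis hK x₀ hD0 f hf)
  have h1 := hTr f hf
  have h2 := hTr _ (TIsb_homeo τ hf)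
  simp only [hτ2] at h2
  rw [h1] at h2
  by_cases hTf : T f = 0
  · rw [h1, hTf, mul_zero]
  · have h3 : ((r : ℂ) * r) = 1 := by
      have : ((r : ℂ) * r - 1) * T f = 0 := by linear_combination -h2
      rcases mul_eq_zero.mp this with h | h
      · exact sub_eq_zero.mp h
      · exact absurd h hTf
    have h4 : r * r = 1 := by exact_mod_cast h3
    have h5 : r = 1 := by nlinarith
    rw [h1, h5]; simp

/-- Existence of compact open subgroups. -/
theorem TI_vanDantzig (G : Type*) [Group G] [TopologicalSpace G] [IsTopologicalGroup G] [T2Space G]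
    [LocallyCompactSpace G] [TotallyDisconnectedSpace G] (U : Set G) (hU : U ∈ 𝓝 (1 : G)) :
    ∃ K : Subgroup G, IsOpen (K : Set G) ∧ IsCompact (K : Set G) ∧ (K : Set G) ⊆ U := by
  obtain ⟨C, hC, hCU, hCc⟩ := local_compact_nhds hU
  obtain ⟨W, hWclopen, h1W, hWC⟩ :=
    (loc_compact_Haus_tot_disc_of_zero_dim (H := G)).mem_nhds_iff.mp hC
  have hWc : IsCompact W := hCc.of_isClosed_subset hWclopen.1 hWC
  have hV : {g : G | ∀ w ∈ W, w * g ∈ W} ∈ 𝓝 (1 : G) := by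
    have := hWc.eventually_forall_of_forall_eventually (x₀ := (1 : G))
      (P := fun g w => w * g ∈ W) ?_
    · exact this
    · intro w hw
      have hc : Continuous (fun z : G × G => z.2 * z.1) := by fun_prop
      exact (hWclopen.2.preimage hc).mem_nhds (by simpa using hw)
  let K : Subgroup G :=
    { carrier := {g : G | (∀ w ∈ W, w * g ∈ W) ∧ ∀ w ∈ W, w * g⁻¹ ∈ W}
      mul_mem' := by
        rintro a b ⟨ha, ha'⟩ ⟨hb, hb'⟩
        refine ⟨fun w hw => ?_, fun w hw => ?_⟩
        · rw [← mul_assoc]; exact hb _ (ha _ hw)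
        · rw [_root_.mul_inv_rev, ← mul_assoc]; exact ha' _ (hb' _ hw)
      one_mem' := by simp
      inv_mem' := by
        rintro a ⟨ha, ha'⟩
        exact ⟨ha', by simpa using ha⟩ }
  have hKo : IsOpen (K : Set G) := by
    apply K.isOpen_of_mem_nhds (g := 1)
    have hV' : (fun g : G => g⁻¹) ⁻¹' {g : G | ∀ w ∈ W, w * g ∈ W} ∈ 𝓝 (1 : G) := by
      apply (continuous_inv (G := G)).continuousAt.preimage_mem_nhds
      simpa using hV
    exact Filter.inter_mem hV hV'
  have hKW : (K : Set G) ⊆ W := fun g hg => by simpa using hg.1 1 h1W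
  exact ⟨K, hKo, hWc.of_isClosed_subset (K.isClosed_of_isOpen hKo) hKW,
    hKW.trans (hWC.trans hCU)⟩

/-- Main abstract statement, without assuming openness of the orbit maps. -/
theorem TISemi.invariant' {χ : G →* ℂ} [T2Space G] [LocallyCompactSpace G]
    [SigmaCompactSpace G] [TotallyDisconnectedSpace G]
    (htrans : ∀ x y : X, ∃ g : G, g • x = y)
    (hker : {g : G | χ g = 1} ∈ 𝓝 (1 : G))
    (θ : G ≃* G) (hθ : Continuous θ) (hθ2 : ∀ g, θ (θ g) = g) (hχθ : ∀ g, χ (θ g) = χ g)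
    (τ : X ≃ₜ X) (hτ2 : ∀ x, τ (τ x) = x) (hτ : ∀ (g : G) (x : X), τ (g • x) = θ g • τ x)
    (x₀ : X) (h : G) (hh : χ h = 1) (hx₀ : τ x₀ = h • x₀)
    {T : (X → ℂ) → ℂ} (hT : TISemi χ T) (f : X → ℂ) (hf : f ∈ TIsb X) :
    T (fun x => f (τ x)) = T f := by
  by_cases hf0 : f = 0
  · subst hf0; rfl
  obtain ⟨y, hy⟩ : ∃ y, f y ≠ 0 := by
    by_contra hcon
    push Not at hcon
    exact hf0 (funext hcon)
  have hoy : IsOpen {z | f z ≠ 0} := hf.1 {0}ᶜ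
  have hy' : tsupport f ∈ 𝓝 y := Filter.mem_of_superset (hoy.mem_nhds hy) (subset_tsupport f)
  have : WeaklyLocallyCompactSpace X := by
    refine ⟨fun x => ?_⟩
    obtain ⟨g, rfl⟩ := htrans y x
    refine ⟨(fun z => g • z) '' tsupport f, hf.2.isCompact.image (by fun_prop), ?_⟩
    exact (Homeomorph.smul g).isOpenMap.image_mem_nhds hy'
  have : MulAction.IsPretransitive G X := ⟨fun x y => htrans x y⟩
  have hbasis : ∀ U ∈ 𝓝 (1 : G), ∃ K : Subgroup G, TIGood χ K ∧ (K : Set G) ⊆ U := by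
    intro U hU
    obtain ⟨K, h1, h2, h3⟩ := TI_vanDantzig G _ (Filter.inter_mem hU hker)
    exact ⟨K, ⟨h1, h2, fun k hk => (h3 hk).2⟩, fun k hk => (h3 hk).1⟩
  exact hT.invariant (fun x => isOpenMap_smul_of_sigmaCompact x) htrans hbasis θ hθ hθ2 hχθ τ hτ2 hτ
    x₀ h hh hx₀ f hf

end AbstractPart

/-! ### Block matrices -/

section Blocks

theorem TI_blk_ext {M N : Fin 3 → Fin 3 → M2 k} (h00 : M 0 0 = N 0 0) (h01 : M 0 1 = N 0 1)
    (h02 : M 0 2 = N 0 2) (h10 : M 1 0 = N 1 0) (h11 : M 1 1 = N 1 1) (h12 : M 1 2 = N 1 2)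
    (h20 : M 2 0 = N 2 0) (h21 : M 2 1 = N 2 1) (h22 : M 2 2 = N 2 2) : blk M = blk N := by
  have : M = N := by
    funext i j
    fin_cases i <;> fin_cases j <;> assumption
  rw [this]

/-- Extraction of a block. -/
def TIsub (i j : Fin 3) (m : M6 k) : M2 k :=
  Matrix.of fun a b => m ⟨2 * i.val + a.val, by omega⟩ ⟨2 * j.val + b.val, by omega⟩

theorem TIsub_blk (i j : Fin 3) (M : Fin 3 → Fin 3 → M2 k) : TIsub i j (blk M) = M i j := by
  ext a b
  fin_cases i <;> fin_cases j <;> fin_cases a <;> fin_cases b <;> rfl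

theorem TI_blk_mul (M N : Fin 3 → Fin 3 → M2 k) :
    blk M * blk N = blk (fun i j => M i 0 * N 0 j + M i 1 * N 1 j + M i 2 * N 2 j) := by
  ext i j
  simp only [blk, Matrix.mul_apply, Matrix.of_apply, Fin.sum_univ_six, Matrix.add_apply,
    Fin.sum_univ_two]
  simp only [← add_assoc]
  rfl

theorem TI_blk_transpose (M : Fin 3 → Fin 3 → M2 k) :
    (blk M)ᵀ = blk (fun i j => (M j i)ᵀ) := rfl

theorem TI_blk_one : (1 : M6 k) = blk ![![1, 0, 0], ![0, 1, 0], ![0, 0, 1]] := by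
  ext i j
  fin_cases i <;> fin_cases j <;> rfl

theorem TI_blk_smul (c : k) (M : Fin 3 → Fin 3 → M2 k) :
    c • blk M = blk (fun i j => c • M i j) := rfl

/-- Block form of elements of `S`. -/
def TItri (a b c d : M2 k) : M6 k := blk ![![a, b, c], ![0, a, d], ![0, 0, a]]

theorem TItri_mul (a b c d a' b' c' d' : M2 k) :
    TItri a b c d * TItri a' b' c' d' =
      TItri (a * a') (a * b' + b * a') (a * c' + b * d' + c * a') (a * d' + d * a') := by
  unfold TItri
  rw [TI_blk_mul]
  apply TI_blk_ext <;> simp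

theorem TI_D_mul_U (a X Y Z : M2 k) :
    Dmat a * Umat X Y Z = TItri a (a * X) (a * Z) (a * Y) := by
  unfold TItri Dmat Umat bdiag
  rw [TI_blk_mul]
  apply TI_blk_ext <;> simp

theorem TI_J_det (a : M2 k) : a * Jmat * aᵀ = a.det • (Jmat : M2 k) := by
  ext i j
  fin_cases i <;> fin_cases j <;>
    simp [Jmat, Matrix.mul_apply, Fin.sum_univ_two, Matrix.det_fin_two] <;> ring

theorem TI_D_J3 (a : M2 k) : Dmat a * J3 * (Dmat a)ᵀ = a.det • (J3 : M6 k) := by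
  unfold Dmat bdiag J3
  rw [TI_blk_transpose, TI_blk_mul, TI_blk_mul, TI_blk_smul]
  apply TI_blk_ext <;> simp [TI_J_det]

theorem TI_U_J3 (X Y Z : M2 k) : Umat X Y Z * J3 * (Umat X Y Z)ᵀ =
    blk ![![Z * Jmat + X * Jmat * Xᵀ + Jmat * Zᵀ, X * Jmat + Jmat * Yᵀ, Jmat],
      ![Y * Jmat + Jmat * Xᵀ, Jmat, 0], ![Jmat, 0, 0]] := by
  unfold Umat J3
  rw [TI_blk_transpose, TI_blk_mul, TI_blk_mul]
  apply TI_blk_ext <;> simp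

theorem TI_J_transpose : (Jmat : M2 k)ᵀ = -Jmat := by
  ext i j
  fin_cases i <;> fin_cases j <;> simp [Jmat]

theorem TI_U_iff (X Y Z : M2 k) : Umat X Y Z * J3 * (Umat X Y Z)ᵀ = J3 ↔
    X * Jmat + Jmat * Yᵀ = 0 ∧ Z * Jmat + Jmat * Zᵀ = -(X * Jmat * Xᵀ) := by
  rw [TI_U_J3]
  constructor
  · intro h
    have h1 := congrArg (TIsub 0 1) h
    have h2 := congrArg (TIsub 0 0) h
    unfold J3 at h1 h2
    rw [TIsub_blk, TIsub_blk] at h1 h2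
    simp at h1 h2
    refine ⟨h1, ?_⟩
    rw [eq_neg_iff_add_eq_zero, ← h2]
    abel
  · rintro ⟨h1, h2⟩
    have h3 : Y * Jmat + Jmat * Xᵀ = 0 := by
      have := congrArg Matrix.transpose h1
      simp only [Matrix.transpose_add, Matrix.transpose_mul, TI_J_transpose,
        Matrix.transpose_transpose, Matrix.transpose_zero] at this
      rw [← neg_eq_zero, ← this]
      simp only [Matrix.mul_neg, Matrix.neg_mul]
      abel
    have h4 : Z * Jmat + X * Jmat * Xᵀ + Jmat * Zᵀ = 0 := by
      rw [eq_neg_iff_add_eq_zero] at h2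
      rw [← h2]; abel
    rw [h1, h3, h4]
    rfl

theorem TI_mem_S_iff (m : M6 k) : m ∈ Sgrp k ↔
    ∃ a b c d : M2 k, IsUnit a ∧ m = TItri a b c d ∧ m * J3 * mᵀ = a.det • (J3 : M6 k) := by
  constructor
  · rintro ⟨_, ⟨a, ha, rfl⟩, _, ⟨X, Y, Z, h1, h2, rfl⟩, rfl⟩
    refine ⟨a, a * X, a * Z, a * Y, ha, TI_D_mul_U a X Y Z, ?_⟩
    have h3 := (TI_U_iff X Y Z).mpr ⟨h1, h2⟩
    simp only [Matrix.transpose_mul]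
    rw [← TI_D_J3 a]
    conv_rhs => rw [← h3]
    simp only [Matrix.mul_assoc]
  · rintro ⟨a, b, c, d, ha, hm, h⟩
    have had : IsUnit a.det := (Matrix.isUnit_iff_isUnit_det a).mp ha
    have hm' : m = Dmat a * Umat (a⁻¹ * b) (a⁻¹ * d) (a⁻¹ * c) := by
      rw [TI_D_mul_U, hm]
      simp only [Matrix.mul_nonsing_inv_cancel_left _ _ had]
    have hU : Umat (a⁻¹ * b) (a⁻¹ * d) (a⁻¹ * c) * J3 * (Umat (a⁻¹ * b) (a⁻¹ * d) (a⁻¹ * c))ᵀ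
        = J3 := by
      set U := Umat (a⁻¹ * b) (a⁻¹ * d) (a⁻¹ * c) with hUdef
      have hD : Dmat a⁻¹ * Dmat a = (1 : M6 k) := by
        unfold Dmat bdiag
        rw [TI_blk_mul, TI_blk_one]
        apply TI_blk_ext <;> simp [Matrix.nonsing_inv_mul _ had]
      have hU' : U = Dmat a⁻¹ * m := by rw [hm', ← Matrix.mul_assoc, hD, Matrix.one_mul]
      have : U * J3 * Uᵀ = Dmat a⁻¹ * (m * J3 * mᵀ) * (Dmat a⁻¹)ᵀ := by
        rw [hU', Matrix.transpose_mul]; simp only [Matrix.mul_assoc]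
      rw [this, h, Matrix.mul_smul, Matrix.smul_mul, TI_D_J3, smul_smul, ← Matrix.det_mul,
        Matrix.mul_nonsing_inv _ had, Matrix.det_one, one_smul]
    rw [TI_U_iff] at hU
    exact ⟨_, ⟨a, ha, rfl⟩, _, ⟨_, _, _, hU.1, hU.2, rfl⟩, hm'.symm⟩

theorem TI_S_mul {m n : M6 k} (hm : m ∈ Sgrp k) (hn : n ∈ Sgrp k) : m * n ∈ Sgrp k := by
  rw [TI_mem_S_iff] at *
  obtain ⟨a, b, c, d, ha, hm, h⟩ := hm
  obtain ⟨a', b', c', d', ha', hn, h'⟩ := hn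
  refine ⟨_, _, _, _, ha.mul ha', by rw [hm, hn, TItri_mul], ?_⟩
  have : m * n * J3 * (m * n)ᵀ = m * (n * J3 * nᵀ) * mᵀ := by
    rw [Matrix.transpose_mul]; simp only [Matrix.mul_assoc]
  rw [this, h', Matrix.mul_smul, Matrix.smul_mul, h, smul_smul, Matrix.det_mul, mul_comm]

theorem TI_D_mem {a : M2 k} (ha : IsUnit a) : Dmat a ∈ Sgrp k := by
  rw [TI_mem_S_iff]
  exact ⟨a, 0, 0, 0, ha, rfl, TI_D_J3 a⟩

theorem TI_D_one : Dmat (1 : M2 k) = 1 := TI_blk_one.symm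

theorem TI_D_mul (a b : M2 k) : Dmat a * Dmat b = Dmat (a * b) := by
  unfold Dmat bdiag
  rw [TI_blk_mul]
  apply TI_blk_ext <;> simp

theorem TI_D_transpose (a : M2 k) : (Dmat a)ᵀ = Dmat aᵀ := by
  unfold Dmat bdiag
  rw [TI_blk_transpose]
  apply TI_blk_ext <;> simp

theorem TI_one_mem : (1 : M6 k) ∈ Sgrp k := by
  rw [← TI_D_one]; exact TI_D_mem isUnit_one

theorem TItri_one : TItri 1 0 0 0 = (1 : M6 k) := TI_blk_one.symm

theorem TI_S_inv {m n : M6 k} (hm : m ∈ Sgrp k) (hmn : m * n = 1) :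
    n ∈ Sgrp k ∧ TIsub 0 0 n = (TIsub 0 0 m)⁻¹ := by
  rw [TI_mem_S_iff] at *
  obtain ⟨a, b, c, d, ha, hm, h⟩ := hm
  have had : IsUnit a.det := (Matrix.isUnit_iff_isUnit_det a).mp ha
  have hnm : n * m = 1 := mul_eq_one_comm.mp hmn
  have hn : n = TItri a⁻¹ (-(a⁻¹ * b * a⁻¹)) (a⁻¹ * b * a⁻¹ * d * a⁻¹ - a⁻¹ * c * a⁻¹)
      (-(a⁻¹ * d * a⁻¹)) := by
    have h1 : TItri a b c d * TItri a⁻¹ (-(a⁻¹ * b * a⁻¹))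
        (a⁻¹ * b * a⁻¹ * d * a⁻¹ - a⁻¹ * c * a⁻¹) (-(a⁻¹ * d * a⁻¹)) = 1 := by
      rw [TItri_mul, ← TItri_one]
      congr 1
      · exact Matrix.mul_nonsing_inv _ had
      · simp only [Matrix.mul_neg, Matrix.mul_assoc, Matrix.mul_nonsing_inv_cancel_left _ _ had]
        abel
      · simp only [Matrix.mul_neg, Matrix.mul_sub, Matrix.mul_assoc,
          Matrix.mul_nonsing_inv_cancel_left _ _ had]
        abel
      · simp only [Matrix.mul_neg, Matrix.mul_assoc, Matrix.mul_nonsing_inv_cancel_left _ _ had]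
        abel
    rw [← hm] at h1
    calc n = n * (m * _) := by rw [h1, Matrix.mul_one]
      _ = _ := by rw [← Matrix.mul_assoc, hnm, Matrix.one_mul]
  refine ⟨⟨_, _, _, _, (Matrix.isUnit_nonsing_inv_iff).mpr ha, hn, ?_⟩, ?_⟩
  · have h2 : n * (m * J3 * mᵀ) * nᵀ = J3 := by
      have h3 : mᵀ * nᵀ = 1 := by rw [← Matrix.transpose_mul, hnm, Matrix.transpose_one]
      calc n * (m * J3 * mᵀ) * nᵀ = (n * m) * J3 * (mᵀ * nᵀ) := by simp only [Matrix.mul_assoc]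
        _ = J3 := by rw [h3, hnm, Matrix.one_mul, Matrix.mul_one]
    rw [h, Matrix.mul_smul, Matrix.smul_mul] at h2
    rw [← h2, smul_smul, ← Matrix.det_mul, Matrix.nonsing_inv_mul _ had, Matrix.det_one, one_smul, h2]
  · rw [hn, hm]
    unfold TItri
    rw [TIsub_blk, TIsub_blk]
    rfl

theorem TI_J3_ne : (J3 : M6 k) ≠ 0 := by
  intro h
  have h1 : (1 : k) = 0 := congrFun (congrFun h 5) 0
  exact one_ne_zero h1

theorem TI_mem_S_iff' (m : M6 k) : m ∈ Sgrp k ↔ IsUnit m ∧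
    m = TItri (TIsub 0 0 m) (TIsub 0 1 m) (TIsub 0 2 m) (TIsub 1 2 m) ∧
    m * J3 * mᵀ = (TIsub 0 0 m).det • (J3 : M6 k) := by
  constructor
  · intro hm
    have hm2 := hm
    rw [TI_mem_S_iff] at hm2
    obtain ⟨a, b, c, d, ha, hm', h⟩ := hm2
    have had : IsUnit a.det := (Matrix.isUnit_iff_isUnit_det a).mp ha
    have e00 : TIsub 0 0 m = a := by rw [hm']; exact TIsub_blk _ _ _
    have e01 : TIsub 0 1 m = b := by rw [hm']; exact TIsub_blk _ _ _
    have e02 : TIsub 0 2 m = c := by rw [hm']; exact TIsub_blk _ _ _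
    have e12 : TIsub 1 2 m = d := by rw [hm']; exact TIsub_blk _ _ _
    rw [e00, e01, e02, e12]
    refine ⟨?_, hm', h⟩
    rw [Matrix.isUnit_iff_isUnit_det]
    rw [isUnit_iff_ne_zero]
    intro h0
    have hJ : IsUnit ((J3 : M6 k).det) := by
      have : (J3 : M6 k) * (-J3) = 1 := by
        have hJ2 : (Jmat : M2 k) * Jmat = -1 := by
          ext i j
          fin_cases i <;> fin_cases j <;> simp [Jmat, Matrix.mul_apply, Fin.sum_univ_two]
        rw [Matrix.mul_neg]
        unfold J3
        rw [TI_blk_mul, TI_blk_one, ← neg_one_smul k, TI_blk_smul]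
        apply TI_blk_ext <;> simp [hJ2]
      exact Matrix.isUnit_det_of_right_inverse this
    have := congrArg Matrix.det h
    rw [Matrix.det_mul, Matrix.det_mul, h0, Matrix.det_smul] at this
    simp only [zero_mul] at this
    exact (mul_ne_zero (pow_ne_zero _ had.ne_zero) hJ.ne_zero) this.symm
  · rintro ⟨hu, h1, h2⟩
    rw [TI_mem_S_iff]
    refine ⟨_, _, _, _, ?_, h1, h2⟩
    rw [Matrix.isUnit_iff_isUnit_det, isUnit_iff_ne_zero]
    intro h0
    rw [h0, zero_smul] at h2
    obtain ⟨u, rfl⟩ := hu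
    apply TI_J3_ne (k := k)
    have h3 : ((u⁻¹ : (M6 k)ˣ) : M6 k) * ((u : M6 k) * J3 * (u : M6 k)ᵀ) *
        ((u⁻¹ : (M6 k)ˣ) : M6 k)ᵀ = J3 := by
      have h4 : (u : M6 k)ᵀ * ((u⁻¹ : (M6 k)ˣ) : M6 k)ᵀ = 1 := by
        rw [← Matrix.transpose_mul, Units.inv_mul, Matrix.transpose_one]
      calc _ = (((u⁻¹ : (M6 k)ˣ) : M6 k) * (u : M6 k)) * J3 *
            ((u : M6 k)ᵀ * ((u⁻¹ : (M6 k)ˣ) : M6 k)ᵀ) := by simp only [Matrix.mul_assoc]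
        _ = J3 := by rw [h4, Units.inv_mul, Matrix.one_mul, Matrix.mul_one]
    rw [← h3, h2]
    simp

theorem TI_psi {ψk : k → ℂˣ} {ψS : M6 k → ℂˣ} (hψS : IsShalikaCharacter ψk ψS) {m n : M6 k}
    (hm : m ∈ Sgrp k) (hmn : m * n = 1) :
    ψS m = ψk (-((TIsub 0 0 n * TIsub 0 1 m).trace)) := by
  have h0 := (TI_S_inv hm hmn).2
  rw [h0]
  obtain ⟨_, ⟨a, ha, rfl⟩, _, ⟨X, Y, Z, h1, h2, rfl⟩, rfl⟩ := hm
  have had : IsUnit a.det := (Matrix.isUnit_iff_isUnit_det a).mp ha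
  have hU : Umat X Y Z ∈ Sgrp k :=
    ⟨1, ⟨1, isUnit_one, TI_D_one.symm⟩, _, ⟨X, Y, Z, h1, h2, rfl⟩, Matrix.one_mul _⟩
  simp only
  rw [hψS.1 _ (TI_D_mem ha) _ hU, hψS.2.2 a ha, one_mul, hψS.2.1 X Y Z h1 h2, TI_D_mul_U]
  unfold TItri
  rw [TIsub_blk, TIsub_blk]
  simp only [Matrix.cons_val_zero, Matrix.cons_val_one]
  rw [Matrix.nonsing_inv_mul_cancel_left _ _ had]

/-- The Shalika subgroup as a subgroup of `GL6`. -/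
def TISub (k : Type*) [Field k] : Subgroup (M6 k)ˣ where
  carrier := {u | (u : M6 k) ∈ Sgrp k}
  mul_mem' := fun {a b} ha hb => by
    simp only [Set.mem_ofPred_eq, Units.val_mul] at *
    exact TI_S_mul ha hb
  one_mem' := by
    simp only [Set.mem_ofPred_eq, Units.val_one]
    exact TI_one_mem
  inv_mem' := fun {a} ha => (TI_S_inv ha (Units.mul_inv a)).1

theorem TI_exists_unit {m : M6 k} (hm : m ∈ Sgrp k) :
    ∃ u : TISub k, ((u : (M6 k)ˣ) : M6 k) = m := by
  obtain ⟨u, hu⟩ := ((TI_mem_S_iff' m).mp hm).1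
  exact ⟨⟨u, by change (u : M6 k) ∈ Sgrp k; rwa [hu]⟩, hu⟩

end Blocks

/-! ### Topology of the Shalika group and its action -/

section Action

set_option linter.unusedSectionVars false

variable [TopologicalSpace k] [IsTopologicalRing k]

theorem TI_cont_sub (i j : Fin 3) : Continuous (TIsub i j : M6 k → M2 k) :=
  continuous_matrix fun _ _ => continuous_id.matrix_elem _ _

theorem TI_cont_tri : Continuous (fun m : M6 k =>
    TItri (TIsub 0 0 m) (TIsub 0 1 m) (TIsub 0 2 m) (TIsub 1 2 m)) := by
  refine continuous_matrix fun i j => ?_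
  have h : ∀ (a b : Fin 3) (c d : Fin 2), Continuous fun m : M6 k => TIsub a b m c d :=
    fun a b c d => (TI_cont_sub a b).matrix_elem c d
  fin_cases i <;> fin_cases j <;> first | exact h _ _ _ _ | exact continuous_const

theorem TI_isClosed [T2Space k] : IsClosed (TISub k : Set (M6 k)ˣ) := by
  have e : (TISub k : Set (M6 k)ˣ) =
      {u : (M6 k)ˣ | (u : M6 k) = TItri (TIsub 0 0 (u : M6 k)) (TIsub 0 1 (u : M6 k))
        (TIsub 0 2 (u : M6 k)) (TIsub 1 2 (u : M6 k))} ∩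
      {u : (M6 k)ˣ | (u : M6 k) * J3 * (u : M6 k)ᵀ =
        (TIsub 0 0 (u : M6 k)).det • (J3 : M6 k)} := by
    ext u
    change (u : M6 k) ∈ Sgrp k ↔ _
    rw [TI_mem_S_iff']
    exact ⟨fun h => h.2, fun h => ⟨u.isUnit, h⟩⟩
  rw [e]
  have hv : Continuous (fun u : (M6 k)ˣ => (u : M6 k)) := Units.continuous_val
  refine (isClosed_eq hv (TI_cont_tri.comp hv)).inter (isClosed_eq ?_ ?_)
  · exact (hv.matrix_mul continuous_const).matrix_mul hv.matrix_transpose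
  · exact (((TI_cont_sub 0 0).comp hv).matrix_det).smul continuous_const

theorem TI_S_top [T2Space k] [LocallyCompactSpace k] [SigmaCompactSpace k]
    [TotallyDisconnectedSpace k] : T2Space (TISub k) ∧ LocallyCompactSpace (TISub k) ∧
      SigmaCompactSpace (TISub k) ∧ TotallyDisconnectedSpace (TISub k) := by
  have i1 : LocallyCompactSpace (M6 k) :=
    inferInstanceAs (LocallyCompactSpace (Fin 6 → Fin 6 → k))
  have i2 : SigmaCompactSpace (M6 k) :=
    inferInstanceAs (SigmaCompactSpace (Fin 6 → Fin 6 → k))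
  have i3 : TotallyDisconnectedSpace (M6 k) :=
    inferInstanceAs (TotallyDisconnectedSpace (Fin 6 → Fin 6 → k))
  have i4 : T2Space (M6 k) := inferInstanceAs (T2Space (Fin 6 → Fin 6 → k))
  have hc := (Units.isClosedEmbedding_embedProduct (α := M6 k))
  have i5 : LocallyCompactSpace (M6 k)ᵐᵒᵖ := inferInstance
  have i6 : SigmaCompactSpace (M6 k)ᵐᵒᵖ :=
    (MulOpposite.opHomeomorph (M := M6 k)).symm.isClosedEmbedding.sigmaCompactSpace
  have hS := hc.comp (TI_isClosed (k := k)).isClosedEmbedding_subtypeVal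
  refine ⟨hS.isEmbedding.t2Space, hS.locallyCompactSpace, hS.sigmaCompactSpace, ?_⟩
  have h1 : Function.Injective (fun u : TISub k => ((u : (M6 k)ˣ) : M6 k)) :=
    Units.val_injective.comp Subtype.val_injective
  have h2 : Continuous (fun u : TISub k => ((u : (M6 k)ˣ) : M6 k)) :=
    Units.continuous_val.comp continuous_subtype_val
  refine ⟨fun t _ ht a ha b hb => h1 ?_⟩
  exact (ht.image _ h2.continuousOn).subsingleton ⟨a, ha, rfl⟩ ⟨b, hb, rfl⟩

/-- Coercion of an element of the Shalika group to a matrix. -/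
def TIval (u : TISub k) : M6 k := ((u : (M6 k)ˣ) : M6 k)

theorem TIval_mem (u : TISub k) : TIval u ∈ Sgrp k := u.2

theorem TIval_mul (u v : TISub k) : TIval (u * v) = TIval u * TIval v := rfl

theorem TIval_one : TIval (1 : TISub k) = 1 := rfl

theorem TIval_mul_inv (u : TISub k) : TIval u * TIval u⁻¹ = 1 := by
  rw [← TIval_mul, mul_inv_cancel, TIval_one]

theorem TIval_inv_mul (u : TISub k) : TIval u⁻¹ * TIval u = 1 := by
  rw [← TIval_mul, inv_mul_cancel, TIval_one]

theorem TIval_cont : Continuous (TIval : TISub k → M6 k) :=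
  Units.continuous_val.comp continuous_subtype_val

/-- The double coset. -/
def TIX (g : M6 k) : Set (M6 k) := setT (Sgrp k) * {g} * Sgrp k

theorem TI_mem_X {g x : M6 k} : x ∈ TIX g ↔ ∃ u v : TISub k, x = (TIval u)ᵀ * g * TIval v := by
  constructor
  · rintro ⟨_, ⟨_, ⟨s, hs, rfl⟩, _, rfl, rfl⟩, t, ht, rfl⟩
    obtain ⟨u, hu⟩ := TI_exists_unit hs
    obtain ⟨v, hv⟩ := TI_exists_unit ht
    refine ⟨u, v, ?_⟩
    change _ = (((u : (M6 k)ˣ) : M6 k))ᵀ * _ * ((v : (M6 k)ˣ) : M6 k)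
    rw [hu, hv]
  · rintro ⟨u, v, rfl⟩
    exact ⟨_, ⟨_, ⟨_, TIval_mem u, rfl⟩, _, rfl, rfl⟩, _, TIval_mem v, rfl⟩

theorem TI_act_mem {g x : M6 k} (a b : TISub k) (hx : x ∈ TIX g) :
    (TIval a⁻¹)ᵀ * x * TIval b⁻¹ ∈ TIX g := by
  rw [TI_mem_X] at *
  obtain ⟨u, v, rfl⟩ := hx
  refine ⟨u * a⁻¹, v * b⁻¹, ?_⟩
  rw [TIval_mul, TIval_mul, Matrix.transpose_mul]
  simp only [Matrix.mul_assoc]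

/-- The action of `S × S` on the double coset. -/
instance TIact (g : M6 k) : MulAction (TISub k × TISub k) {m : M6 k // m ∈ TIX g} where
  smul h x := ⟨(TIval h.1⁻¹)ᵀ * x.1 * TIval h.2⁻¹, TI_act_mem h.1 h.2 x.2⟩
  one_smul x := by
    apply Subtype.ext
    change (TIval (1 : TISub k)⁻¹)ᵀ * x.1 * TIval (1 : TISub k)⁻¹ = x.1
    rw [inv_one, TIval_one, Matrix.transpose_one, Matrix.one_mul, Matrix.mul_one]
  mul_smul h h' x := by
    apply Subtype.ext
    change (TIval (h.1 * h'.1)⁻¹)ᵀ * x.1 * TIval (h.2 * h'.2)⁻¹ =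
      (TIval h.1⁻¹)ᵀ * ((TIval h'.1⁻¹)ᵀ * x.1 * TIval h'.2⁻¹) * TIval h.2⁻¹
    rw [_root_.mul_inv_rev, _root_.mul_inv_rev, TIval_mul, TIval_mul, Matrix.transpose_mul]
    simp only [Matrix.mul_assoc]

theorem TIact_val (g : M6 k) (h : TISub k × TISub k) (x : {m : M6 k // m ∈ TIX g}) :
    (h • x).1 = (TIval h.1⁻¹)ᵀ * x.1 * TIval h.2⁻¹ := rfl

instance TIact_cont (g : M6 k) : ContinuousSMul (TISub k × TISub k) {m : M6 k // m ∈ TIX g} where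
  continuous_smul := by
    refine Continuous.subtype_mk (f := fun q : (TISub k × TISub k) × {m : M6 k // m ∈ TIX g} =>
      (TIval q.1.1⁻¹)ᵀ * q.2.1 * TIval q.1.2⁻¹) ?_ _
    have h1 : Continuous fun q : (TISub k × TISub k) × {m : M6 k // m ∈ TIX g} =>
      TIval q.1.1⁻¹ := TIval_cont.comp (continuous_fst.fst.inv)
    have h2 : Continuous fun q : (TISub k × TISub k) × {m : M6 k // m ∈ TIX g} =>
      TIval q.1.2⁻¹ := TIval_cont.comp (continuous_fst.snd.inv)
    have h3 : Continuous fun q : (TISub k × TISub k) × {m : M6 k // m ∈ TIX g} =>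
      q.2.1 := continuous_subtype_val.comp continuous_snd
    exact (h1.matrix_transpose.matrix_mul h3).matrix_mul h2

theorem TI_base_mem (g : M6 k) : g ∈ TIX g :=
  TI_mem_X.mpr ⟨1, 1, by
    rw [TIval_one, Matrix.transpose_one, Matrix.one_mul, Matrix.mul_one]⟩

theorem TI_trans (g : M6 k) (x y : {m : M6 k // m ∈ TIX g}) :
    ∃ h : TISub k × TISub k, h • x = y := by
  have key : ∀ z : {m : M6 k // m ∈ TIX g},
      ∃ h : TISub k × TISub k, h • (⟨g, TI_base_mem g⟩ : {m : M6 k // m ∈ TIX g}) = z := by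
    rintro ⟨z, hz⟩
    obtain ⟨u, v, rfl⟩ := TI_mem_X.mp hz
    refine ⟨(u⁻¹, v⁻¹), Subtype.ext ?_⟩
    rw [TIact_val]
    simp only [inv_inv]
  obtain ⟨a, rfl⟩ := key x
  obtain ⟨b, rfl⟩ := key y
  exact ⟨b * a⁻¹, by rw [smul_smul, inv_mul_cancel_right]⟩

/-- The character of `S × S`. -/
def TIchi {ψk : k → ℂˣ} {ψS : M6 k → ℂˣ} (hψS : IsShalikaCharacter ψk ψS) :
    TISub k × TISub k →* ℂ where
  toFun h := (((ψS (TIval h.1) * ψS (TIval h.2))⁻¹ : ℂˣ) : ℂ)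
  map_one' := by
    have : ψS (1 : M6 k) = 1 := by rw [← TI_D_one]; exact hψS.2.2 1 isUnit_one
    change (((ψS (1 : M6 k) * ψS (1 : M6 k))⁻¹ : ℂˣ) : ℂ) = 1
    rw [this]; simp
  map_mul' h h' := by
    rw [Prod.fst_mul, Prod.snd_mul, TIval_mul, TIval_mul, hψS.1 _ (TIval_mem _) _ (TIval_mem _),
      hψS.1 _ (TIval_mem _) _ (TIval_mem _), ← Units.val_mul, mul_mul_mul_comm, mul_inv]

theorem TIchi_apply {ψk : k → ℂˣ} {ψS : M6 k → ℂˣ} (hψS : IsShalikaCharacter ψk ψS)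
    (h : TISub k × TISub k) :
    TIchi hψS h = (((ψS (TIval h.1) * ψS (TIval h.2))⁻¹ : ℂˣ) : ℂ) := rfl

theorem TI_psi_ker {ψk : k → ℂˣ} (hlc : IsLocallyConstant ψk)
    {ψS : M6 k → ℂˣ} (hψS : IsShalikaCharacter ψk ψS) :
    {u : TISub k | ψS (TIval u) = 1} ∈ nhds (1 : TISub k) := by
  have hc : Continuous fun u : TISub k => -((TIsub 0 0 (TIval u⁻¹) * TIsub 0 1 (TIval u)).trace) :=
    ((((TI_cont_sub 0 0).comp (TIval_cont.comp continuous_inv)).matrix_mul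
      ((TI_cont_sub 0 1).comp TIval_cont)).matrix_trace).neg
  have e : {u : TISub k | ψS (TIval u) = 1} =
      (fun u : TISub k => -((TIsub 0 0 (TIval u⁻¹) * TIsub 0 1 (TIval u)).trace)) ⁻¹'
        (ψk ⁻¹' {1}) := by
    ext u
    change ψS (TIval u) = 1 ↔ ψk _ = 1
    rw [TI_psi hψS (TIval_mem u) (TIval_mul_inv u)]
  have h1 : ψS (TIval (1 : TISub k)) = 1 := by
    rw [TIval_one, ← TI_D_one]; exact hψS.2.2 1 isUnit_one
  refine IsOpen.mem_nhds ?_ h1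
  rw [e]
  exact (hlc.isOpen_fiber 1).preimage hc

theorem TIchi_ker {ψk : k → ℂˣ} (hlc : IsLocallyConstant ψk)
    {ψS : M6 k → ℂˣ} (hψS : IsShalikaCharacter ψk ψS) :
    {h | TIchi hψS h = 1} ∈ nhds (1 : TISub k × TISub k) := by
  have := prod_mem_nhds (TI_psi_ker hlc hψS) (TI_psi_ker hlc hψS)
  refine Filter.mem_of_superset this ?_
  rintro ⟨a, b⟩ ⟨ha, hb⟩
  change ψS (TIval a) = 1 at ha
  change ψS (TIval b) = 1 at hb
  change TIchi hψS (a, b) = 1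
  rw [TIchi_apply, ha, hb]; simp

theorem TI_setT_X {g : M6 k} {s1 s2 : TISub k} (h : TIval s1 * g * TIval s2 = gᵀ)
    (hs1 : (TIval s1)ᵀ ∈ Sgrp k) {x : M6 k} (hx : x ∈ TIX g) : xᵀ ∈ TIX g := by
  obtain ⟨u, v, rfl⟩ := TI_mem_X.mp hx
  obtain ⟨w, hw⟩ := TI_exists_unit hs1
  have hw' : TIval w = (TIval s1)ᵀ := hw
  refine TI_mem_X.mpr ⟨w * v, s2 * u, ?_⟩
  simp only [Matrix.transpose_mul, Matrix.transpose_transpose, TIval_mul, hw', ← h,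
    Matrix.mul_assoc]

theorem TI_main_aux [T2Space k] [LocallyCompactSpace k] [SigmaCompactSpace k]
    [TotallyDisconnectedSpace k] {ψk : k → ℂˣ} (hlc : IsLocallyConstant ψk)
    {ψS : M6 k → ℂˣ} (hψS : IsShalikaCharacter ψk ψS) {g : M6 k} {a b : M2 k}
    (ha : IsUnit a) (hb : IsUnit b) (hab : Dmat a * g * Dmat b = gᵀ) :
    setT (TIX g) = TIX g ∧
    ∀ T : ({m : M6 k // m ∈ TIX g} → ℂ) → ℂ, IsInvariantDistrib ψS (TIX g) T →
      ∀ f ∈ Cc (TIX g), ∀ f' ∈ Cc (TIX g),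
        (∀ (x : M6 k) (hx : x ∈ TIX g) (hx' : xᵀ ∈ TIX g), f' ⟨x, hx⟩ = f ⟨xᵀ, hx'⟩) →
        T f' = T f := by
  have hat : IsUnit aᵀ := (Matrix.isUnit_transpose a).mpr ha
  have had : IsUnit a.det := (Matrix.isUnit_iff_isUnit_det a).mp ha
  obtain ⟨s1, hs1⟩ := TI_exists_unit (TI_D_mem ha)
  obtain ⟨s1t, hs1t⟩ := TI_exists_unit (TI_D_mem hat)
  obtain ⟨s2, hs2⟩ := TI_exists_unit (TI_D_mem hb)
  change TIval s1 = _ at hs1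
  change TIval s1t = _ at hs1t
  change TIval s2 = _ at hs2
  have hT1 : ∀ x ∈ TIX g, xᵀ ∈ TIX g := fun x hx =>
    TI_setT_X (s1 := s1) (s2 := s2) (by rw [hs1, hs2, hab])
      (by rw [hs1, TI_D_transpose]; exact TI_D_mem hat) hx
  refine ⟨?_, ?_⟩
  · ext x
    constructor
    · rintro ⟨y, hy, rfl⟩
      exact hT1 y hy
    · intro hx
      exact ⟨xᵀ, hT1 x hx, Matrix.transpose_transpose x⟩
  intro T hT f hf f' hf' hff
  obtain ⟨j1, j2, j3, j4⟩ := TI_S_top (k := k)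
  have j5 : T2Space (M6 k) := inferInstanceAs (T2Space (Fin 6 → Fin 6 → k))
  let τ : {m : M6 k // m ∈ TIX g} ≃ₜ {m : M6 k // m ∈ TIX g} :=
    { toFun := fun x => ⟨x.1ᵀ, hT1 _ x.2⟩
      invFun := fun x => ⟨x.1ᵀ, hT1 _ x.2⟩
      left_inv := fun x => Subtype.ext (Matrix.transpose_transpose x.1)
      right_inv := fun x => Subtype.ext (Matrix.transpose_transpose x.1)
      continuous_toFun := continuous_subtype_val.matrix_transpose.subtype_mk _
      continuous_invFun := continuous_subtype_val.matrix_transpose.subtype_mk _ }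
  have hf'τ : f' = fun x => f (τ x) := by
    funext x
    exact hff x.1 x.2 (hT1 _ x.2)
  have hsemi : TISemi (TIchi hψS) T := by
    refine ⟨hT.1, hT.2.1, ?_⟩
    intro h F hF
    have hF2 : (fun x => F (h⁻¹ • x)) ∈ TIsb {m : M6 k // m ∈ TIX g} :=
      TIsb_homeo (Homeomorph.smul h⁻¹) hF
    have hinv : ((TIval h.1⁻¹)ᵀ)⁻¹ = (TIval h.1)ᵀ := by
      apply Matrix.inv_eq_left_inv
      rw [← Matrix.transpose_mul, TIval_inv_mul, Matrix.transpose_one]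
    have := hT.2.2 (TIval h.1⁻¹)ᵀ ⟨_, TIval_mem _, rfl⟩ (TIval h.2) (TIval_mem _) F _ hF hF2 ?_
    · rw [this, Matrix.transpose_transpose, TIchi_apply]
      have h1 : ψS (TIval h.1⁻¹) = (ψS (TIval h.1))⁻¹ := by
        rw [eq_inv_iff_mul_eq_one, ← hψS.1 _ (TIval_mem _) _ (TIval_mem _), TIval_inv_mul,
          ← TI_D_one]
        exact hψS.2.2 1 isUnit_one
      rw [h1, mul_inv, Units.val_mul, Units.val_inv_eq_inv_val (ψS (TIval h.2))]
    · intro x hx hx'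
      refine congrArg F (Subtype.ext ?_)
      rw [TIact_val]
      simp only [Prod.fst_inv, Prod.snd_inv, inv_inv]
      rw [hinv]
  have hψs1 : ψS (TIval s1t⁻¹) = 1 := by
    have h1 : ψS (TIval s1t⁻¹) * ψS (TIval s1t) = 1 := by
      rw [← hψS.1 _ (TIval_mem _) _ (TIval_mem _), TIval_inv_mul, ← TI_D_one]
      exact hψS.2.2 1 isUnit_one
    rwa [hs1t, hψS.2.2 _ hat, mul_one] at h1
  have hψs2 : ψS (TIval s2⁻¹) = 1 := by
    have h1 : ψS (TIval s2⁻¹) * ψS (TIval s2) = 1 := by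
      rw [← hψS.1 _ (TIval_mem _) _ (TIval_mem _), TIval_inv_mul, ← TI_D_one]
      exact hψS.2.2 1 isUnit_one
    rwa [hs2, hψS.2.2 _ hb, mul_one] at h1
  rw [hf'τ]
  refine TISemi.invariant' (χ := TIchi hψS) (TI_trans g) (TIchi_ker hlc hψS)
    (MulEquiv.prodComm : TISub k × TISub k ≃* TISub k × TISub k) continuous_swap
    (fun _ => rfl) ?_ τ ?_ ?_ ⟨g, TI_base_mem g⟩ (s1t⁻¹, s2⁻¹) ?_ ?_ hsemi f hf
  · intro h
    change TIchi hψS (h.2, h.1) = TIchi hψS h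
    rw [TIchi_apply, TIchi_apply, mul_comm]
  · exact fun x => Subtype.ext (Matrix.transpose_transpose x.1)
  · intro h x
    refine Subtype.ext ?_
    change ((TIval h.1⁻¹)ᵀ * x.1 * TIval h.2⁻¹)ᵀ = (TIval h.2⁻¹)ᵀ * x.1ᵀ * TIval h.1⁻¹
    simp only [Matrix.transpose_mul, Matrix.transpose_transpose, Matrix.mul_assoc]
  · rw [TIchi_apply]
    simp only
    rw [hψs1, hψs2]; simp
  · refine Subtype.ext ?_
    change gᵀ = (TIval (s1t⁻¹)⁻¹)ᵀ * g * TIval (s2⁻¹)⁻¹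
    rw [inv_inv, inv_inv, hs1t, hs2, TI_D_transpose, Matrix.transpose_transpose, hab]

end Action

/-- Transpose-invariance criterion TI.  Let `g ∈ GSp6(k)` and `X = Sᵀ·g·S`.
If there exist `s1, s2 ∈ Δ(GL2)` with `s1·g·s2 = gᵀ`, then `Xᵀ = X` and every
`(S,ψ,T)`-invariant distribution `T` on `X` is transpose-invariant:
`T(x ↦ f(xᵀ)) = T(f)` for all `f ∈ C_c^∞(X)`. -/
theorem invariant_distribution_transpose_invariant_TI
    {p : ℕ} [Fact p.Prime] {k : Type*} [NontriviallyNormedField k]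
    [NormedAlgebra ℚ_[p] k] [FiniteDimensional ℚ_[p] k]
    (ψk : k → ℂˣ) (hψk : ∀ x y : k, ψk (x + y) = ψk x * ψk y)
    (hnt : ∃ x : k, ψk x ≠ 1) (hlc : IsLocallyConstant ψk)
    (ψS : M6 k → ℂˣ) (hψS : IsShalikaCharacter ψk ψS)
    (g : M6 k) (hg : g ∈ GSp6 k)
    (X : Set (M6 k)) (hX : X = setT (Sgrp k) * {g} * Sgrp k)
    (hs : ∃ s1 ∈ DeltaGL2 k, ∃ s2 ∈ DeltaGL2 k, s1 * g * s2 = gᵀ) :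
    setT X = X ∧
    ∀ T : ({m : M6 k // m ∈ X} → ℂ) → ℂ, IsInvariantDistrib ψS X T →
      ∀ f ∈ Cc X, ∀ f' ∈ Cc X,
        (∀ (x : M6 k) (hx : x ∈ X) (hx' : xᵀ ∈ X), f' ⟨x, hx⟩ = f ⟨xᵀ, hx'⟩) →
        T f' = T f := by
  have hp : ProperSpace k := FiniteDimensional.proper ℚ_[p] k
  have htd : TotallyDisconnectedSpace k := by
    let e := (Module.finBasis ℚ_[p] k).equivFunL
    refine ⟨fun t _ ht a ha b hb => e.injective ?_⟩
    exact (ht.image _ e.continuous.continuousOn).subsingleton ⟨a, ha, rfl⟩ ⟨b, hb, rfl⟩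
  obtain ⟨_, ⟨a, ha, rfl⟩, _, ⟨b, hb, rfl⟩, hab⟩ := hs
  subst hX
  exact TI_main_aux hlc hψS ha hb hab
end

section
/- For all x, y ∈ GL2(k), the pair (xᵀ, yᵀ) lies in the same orbit as (x, y) under the action of GL2(k) × GL2(k) on GL2(k) × GL2(k) given by (g,h)·(x,y) = (g·x·h, g·y·h); that is, there exist g, h ∈ GL2(k) with g·x·h = xᵀ and g·y·h = yᵀ. -/
open Matrix

theorem exists_symmetrizer {k : Type*} [Field k] (w : Matrix (Fin 2) (Fin 2) k) :
    ∃ p : Matrix (Fin 2) (Fin 2) k, IsUnit p ∧ p * w = wᵀ * p := by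
  by_cases hb : w 0 1 = 0
  · by_cases hc : w 1 0 = 0
    · refine ⟨1, isUnit_one, ?_⟩
      ext i j
      fin_cases i <;> fin_cases j <;> simp [hb, hc]
    · refine ⟨!![0, w 1 0; w 1 0, w 1 1 - w 0 0], ?_, ?_⟩
      · rw [Matrix.isUnit_iff_isUnit_det, Matrix.det_fin_two_of, isUnit_iff_ne_zero]
        simpa using hc
      · ext i j
        fin_cases i <;> fin_cases j <;> simp [Matrix.mul_apply, Fin.sum_univ_two] <;> ring
  · refine ⟨!![w 0 0 - w 1 1, w 0 1; w 0 1, 0], ?_, ?_⟩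
    · rw [Matrix.isUnit_iff_isUnit_det, Matrix.det_fin_two_of, isUnit_iff_ne_zero]
      simpa using hb
    · ext i j
      fin_cases i <;> fin_cases j <;> simp [Matrix.mul_apply, Fin.sum_univ_two] <;> ring

/-- For all invertible `x, y ∈ GL2(k)`, the pair `(xᵀ, yᵀ)` lies in the same
orbit as `(x, y)` under the action `(g,h)·(x,y) = (g·x·h, g·y·h)` of `GL2(k) × GL2(k)`:
there exist invertible `g, h` with `g·x·h = xᵀ` and `g·y·h = yᵀ`. -/
theorem transpose_pair_in_orbit {k : Type*} [Field k]
    (x y : Matrix (Fin 2) (Fin 2) k) (hx : IsUnit x) (hy : IsUnit y) :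
    ∃ g h : Matrix (Fin 2) (Fin 2) k, IsUnit g ∧ IsUnit h ∧
      g * x * h = xᵀ ∧ g * y * h = yᵀ := by
  obtain ⟨p, hp, hpw⟩ := exists_symmetrizer (x⁻¹ * y)
  have hxd := (Matrix.isUnit_iff_isUnit_det x).1 hx
  have hpd := (Matrix.isUnit_iff_isUnit_det p).1 hp
  refine ⟨p * x⁻¹, p⁻¹ * xᵀ, hp.mul ?_, IsUnit.mul ?_ ?_, ?_, ?_⟩
  · exact Matrix.isUnit_nonsing_inv_iff.2 hx
  · exact Matrix.isUnit_nonsing_inv_iff.2 hp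
  · rw [Matrix.isUnit_iff_isUnit_det, Matrix.det_transpose]
    exact hxd
  · rw [Matrix.mul_assoc p, Matrix.nonsing_inv_mul x hxd, Matrix.mul_one,
      ← Matrix.mul_assoc, Matrix.mul_nonsing_inv p hpd, Matrix.one_mul]
  · rw [Matrix.mul_assoc p, hpw, Matrix.mul_assoc, ← Matrix.mul_assoc p,
      Matrix.mul_nonsing_inv p hpd, Matrix.one_mul, ← Matrix.transpose_mul,
      ← Matrix.mul_assoc, Matrix.mul_nonsing_inv x hxd, Matrix.one_mul]
end

section
/- Let A be a (not necessarily associative, not necessarily unital) ring satisfying the left alternative law (x·x)·y = x·(x·y) and the right alternative law (y·x)·x = y·(x·x) for all x, y ∈ A. If α, β ∈ A satisfy α·α = 0, β·β = 0, and (α+β)·(α+β) = 0, then (α·β)·(α·β) = 0. -/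
/-- Let `A` be a (not necessarily associative or unital) ring satisfying the
left and right alternative laws.  If `α, β ∈ A` satisfy `α·α = 0`, `β·β = 0` and
`(α+β)·(α+β) = 0`, then `(α·β)·(α·β) = 0`. -/
theorem alternative_square_zero {A : Type*} [NonUnitalNonAssocRing A]
    (hl : ∀ x y : A, (x * x) * y = x * (x * y))
    (hr : ∀ x y : A, (y * x) * x = y * (x * x))
    (α β : A) (hα : α * α = 0) (hβ : β * β = 0) (hαβ : (α + β) * (α + β) = 0) :
    (α * β) * (α * β) = 0 := by
  have hanti : α * β = -(β * α) := by
    have h := hαβ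
    simp only [mul_add, add_mul, hα, hβ, zero_add, add_zero] at h
    exact eq_neg_of_add_eq_zero_right h
  have h1 : α * (α * β) = 0 := by rw [← hl, hα, zero_mul]
  have h2 : (α * β) * β = 0 := by rw [hr, hβ, mul_zero]
  have h3 : (α * β) * α = 0 := by rw [hanti, neg_mul, hr, hα, mul_zero, neg_zero]
  -- linearized left alternative law at `α * β`, `α`, applied to `β`
  have h := hl (α * β + α) β
  simpa [mul_add, add_mul, h1, h2, h3, hα, hl (α * β) β] using h.symm
end
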